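/- arXiv:2310.10869 — 3 statements merged into one kernel-verified Lean document; each statement's English description precedes it below -/
import Mathlib

section
/- Let n ≥ 2 and let T : ℝⁿ → ℝⁿ be differentiable. Then the following are equivalent: (i) for every orthogonal matrix P = [θ₁, …, θₙ] ∈ O(n) there exist strictly increasing functions f₁, …, fₙ : ℝ → ℝ such that T(x) = Σᵢ₌₁ⁿ fᵢ(⟨x, θᵢ⟩) θᵢ for all x ∈ ℝⁿ; (ii) there exist a > 0 and b ∈ ℝⁿ such that T(x) = ax + b for all x ∈ ℝⁿ. -/
open MeasureTheory Filter
open scoped ENNReal RealInnerProductSpace BigOperators Topology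

noncomputable section

namespace SliceMatching

/-- `ℝⁿ` with its Euclidean structure. -/
abbrev Rn (n : ℕ) := EuclideanSpace ℝ (Fin n)

/-- The cumulative distribution function of a measure on `ℝ`. -/
def cdf (ν : Measure ℝ) (t : ℝ) : ℝ := (ν (Set.Iic t)).toReal

/-- The quantile function (pseudo-inverse of the CDF) of a measure on `ℝ`. -/
def quantile (ρ : Measure ℝ) (p : ℝ) : ℝ := sInf {t : ℝ | p ≤ cdf ρ t}

/-- The one-dimensional optimal transport map `T_ν^ρ = F_ρ⁻¹ ∘ F_ν`. -/
def otMap1d (ν ρ : Measure ℝ) (t : ℝ) : ℝ := quantile ρ (cdf ν t)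

/-- The slice `σ^θ`: pushforward of `σ` under the projection `x ↦ ⟪x, θ⟫`. -/
def slice {n : ℕ} (σ : Measure (Rn n)) (θ : Rn n) : Measure ℝ :=
  σ.map (fun x => ⟪x, θ⟫)

/-- The matrix-slice matching map `T_{σ,μ;P}`, where `P ∈ O(n)` has columns `θ 0, …, θ (n-1)`:
`T_{σ,μ;P}(x) = ∑ i, T_{σ^{θ i}}^{μ^{θ i}}(⟪x, θ i⟫) • θ i`. -/
def smMap {n : ℕ} (σ μ : Measure (Rn n)) (θ : Fin n → Rn n) (x : Rn n) : Rn n :=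
  ∑ i, otMap1d (slice σ (θ i)) (slice μ (θ i)) ⟪x, θ i⟫ • θ i

/-- The squared quadratic Wasserstein distance: the infimum of `∫ ‖x - y‖²` over all
couplings of `σ` and `μ`. -/
def W2sq {α : Type*} [MeasurableSpace α] [NormedAddCommGroup α] (σ μ : Measure α) : ℝ :=
  (⨅ (π : Measure (α × α)) (_ : π.map Prod.fst = σ ∧ π.map Prod.snd = μ),
    ∫⁻ p, ENNReal.ofReal (‖p.1 - p.2‖ ^ 2) ∂π).toReal

/-- The quadratic Wasserstein distance `W₂`. -/
def W2 {α : Type*} [MeasurableSpace α] [NormedAddCommGroup α] (σ μ : Measure α) : ℝ :=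
  Real.sqrt (W2sq σ μ)

/-- If every increment of a map on a vector space of dimension at least two is parallel to the
increment of its argument, then the map is a homothety followed by a translation. -/
theorem exists_eq_smul_add_of_forall_sub_eq_smul {K V : Type*} [Field K] [AddCommGroup V]
    [Module K V] (hV : 1 < Module.finrank K V) (T : V → V)
    (h : ∀ x y, ∃ c : K, T x - T y = c • (x - y)) :
    ∃ (a : K) (b : V), ∀ x, T x = a • x + b := by
  have h_zero : ∀ x, ∃ c : K, T x - T 0 = c • x := fun x => by simpa using h x 0
  choose c hc using h_zero
  have c_eq : ∀ x y, LinearIndependent K ![x, y] → c x = c y := by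
    intro x y hxy
    obtain ⟨d, hd⟩ := h x y
    have hcomb : (c x - d) • x + (d - c y) • y = 0 := by
      have hsub : T x - T y = c x • x - c y • y := by rw [← hc, ← hc]; abel
      rw [hsub] at hd
      linear_combination (norm := module) hd
    obtain ⟨h₁, h₂⟩ := LinearIndependent.pair_iff.1 hxy _ _ hcomb
    exact (sub_eq_zero.1 h₁).trans (sub_eq_zero.1 h₂)
  have : Nontrivial V := Module.nontrivial_of_finrank_pos (R := K) (zero_lt_one.trans hV)
  obtain ⟨x₀, hx₀⟩ := exists_ne (0 : V)
  obtain ⟨y₀, hy₀⟩ := exists_linearIndependent_pair_of_one_lt_finrank hV hx₀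
  refine ⟨c x₀, T 0, fun x => sub_eq_iff_eq_add.1 ?_⟩
  by_cases hx : x = 0
  · simp [hx]
  suffices c x = c x₀ by rw [hc, this]
  by_cases hli : LinearIndependent K ![x₀, x]
  · exact (c_eq _ _ hli).symm
  · rw [LinearIndependent.pair_iff' hx₀] at hli
    push Not at hli
    obtain ⟨t, rfl⟩ := hli
    have ht : t ≠ 0 := fun ht => hx (by simp [ht])
    rw [c_eq x₀ y₀ hy₀]
    refine c_eq _ _ (LinearIndependent.pair_iff.2 fun r s hrs => ?_)
    rw [smul_smul] at hrs
    obtain ⟨h₁, h₂⟩ := LinearIndependent.pair_iff.1 hy₀ _ _ hrs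
    exact ⟨(mul_eq_zero.1 h₁).resolve_right ht, h₂⟩

/-- If `T` is compatible with an orthonormal family, the component of `T x` along a member of the
family is a function of the corresponding component of `x`. -/
theorem inner_eq_of_eq_sum {n : ℕ} {T : Rn n → Rn n} {θ : Fin n → Rn n} (hθ : Orthonormal ℝ θ)
    {f : Fin n → ℝ → ℝ} (hf : ∀ x, T x = ∑ i, f i ⟪x, θ i⟫ • θ i) (i : Fin n) (x : Rn n) :
    ⟪θ i, T x⟫ = f i ⟪x, θ i⟫ := by
  rw [hf, hθ.inner_right_fintype]

/-- A vector of `ℝⁿ` of norm one is the member of any prescribed index of some orthonormal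
family of `n` vectors. -/
theorem exists_orthonormal_apply_eq {n : ℕ} (i : Fin n) {u : Rn n} (hu : ‖u‖ = 1) :
    ∃ θ : Fin n → Rn n, Orthonormal ℝ θ ∧ θ i = u := by
  have hv : Orthonormal ℝ (({i} : Set (Fin n)).domRestrict fun _ => u) :=
    ⟨fun _ => hu, fun j k hjk => (hjk (Subsingleton.elim j k)).elim⟩
  obtain ⟨b, hb⟩ := hv.exists_orthonormalBasis_extension_of_card_eq (by simp)
  exact ⟨b, b.orthonormal, hb i rfl⟩

/-- If `T` is compatible with every orthonormal family, its increments are parallel to the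
increments of its argument. -/
theorem exists_sub_eq_smul_sub {n : ℕ} (hn : 0 < n) {T : Rn n → Rn n}
    (h : ∀ θ : Fin n → Rn n, Orthonormal ℝ θ →
      ∃ f : Fin n → ℝ → ℝ, ∀ x, T x = ∑ i, f i ⟪x, θ i⟫ • θ i) (x y : Rn n) :
    ∃ c : ℝ, T x - T y = c • (x - y) := by
  suffices T x - T y ∈ Submodule.span ℝ {x - y} by
    obtain ⟨c, hc⟩ := Submodule.mem_span_singleton.1 this
    exact ⟨c, hc.symm⟩
  rw [← Submodule.orthogonal_orthogonal (Submodule.span ℝ {x - y}), Submodule.mem_orthogonal]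
  intro w hw
  rw [Submodule.mem_orthogonal_singleton_iff_inner_right] at hw
  by_cases hw0 : w = 0
  · simp [hw0]
  have hw_norm : ‖w‖ ≠ 0 := norm_ne_zero_iff.2 hw0
  obtain ⟨θ, hθ, hθw⟩ := exists_orthonormal_apply_eq ⟨0, hn⟩ (u := ‖w‖⁻¹ • w)
    (by rw [norm_smul, norm_inv, norm_norm, inv_mul_cancel₀ hw_norm])
  obtain ⟨f, hf⟩ := h θ hθ
  have hxy : ⟪x, θ ⟨0, hn⟩⟫ = ⟪y, θ ⟨0, hn⟩⟫ := by
    rw [← sub_eq_zero, ← inner_sub_left, hθw, real_inner_smul_right, hw, mul_zero]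
  have hT : ⟪θ ⟨0, hn⟩, T x - T y⟫ = 0 := by
    rw [inner_sub_right, inner_eq_of_eq_sum hθ hf, inner_eq_of_eq_sum hθ hf, hxy, sub_self]
  rw [hθw, real_inner_smul_left] at hT
  exact (mul_eq_zero.1 hT).resolve_left (inv_ne_zero hw_norm)

/-- A differentiable map on `ℝⁿ` (`n ≥ 2`) is `P`-compatible with strictly
increasing components for every orthogonal `P` if and only if it is an isotropic scaling
with translation `x ↦ a • x + b`, `a > 0`. -/
theorem stmt11 {n : ℕ} (hn : 2 ≤ n)
    (T : Rn n → Rn n) (hT : Differentiable ℝ T) :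
    (∀ θ : Fin n → Rn n, Orthonormal ℝ θ →
        ∃ f : Fin n → ℝ → ℝ, (∀ i, StrictMono (f i)) ∧
          ∀ x, T x = ∑ i, f i ⟪x, θ i⟫ • θ i) ↔
      (∃ a : ℝ, 0 < a ∧ ∃ b : Rn n, ∀ x, T x = a • x + b) := by
  constructor
  · intro h
    have hn0 : 0 < n := by omega
    obtain ⟨a, b, hab⟩ := exists_eq_smul_add_of_forall_sub_eq_smul (K := ℝ)
      (by rw [finrank_euclideanSpace_fin]; omega) T
      (exists_sub_eq_smul_sub hn0 fun θ hθ => (h θ hθ).imp fun _ hf => hf.2)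
    refine ⟨a, ?_, b, hab⟩
    have hθ := (EuclideanSpace.basisFun (Fin n) ℝ).orthonormal
    obtain ⟨f, hf_mono, hf⟩ := h _ hθ
    set u := EuclideanSpace.basisFun (Fin n) ℝ ⟨0, hn0⟩ with hu
    have hu_inner : ⟪u, u⟫ = 1 := by rw [real_inner_self_eq_norm_sq, hθ.1, one_pow]
    have h₀ := inner_eq_of_eq_sum hθ hf ⟨0, hn0⟩ 0
    have h₁ := inner_eq_of_eq_sum hθ hf ⟨0, hn0⟩ u
    rw [← hu, hab, inner_add_right, inner_smul_right] at h₀ h₁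
    rw [inner_zero_right, inner_zero_left] at h₀
    rw [hu_inner] at h₁
    linarith [hf_mono ⟨0, hn0⟩ zero_lt_one]
  · rintro ⟨a, ha, b, hab⟩ θ hθ
    refine ⟨fun i t => a * t + ⟪b, θ i⟫, fun i s t hst => by dsimp only; gcongr, fun x => ?_⟩
    let B := OrthonormalBasis.mk hθ
      (hθ.linearIndependent.span_eq_top_of_card_eq_finrank' (by simp)).ge
    have hB : ∀ y : Rn n, ∑ i, ⟪y, θ i⟫ • θ i = y := fun y => by
      simpa [B, real_inner_comm] using B.sum_repr' y
    simp only [add_smul, mul_smul, Finset.sum_add_distrib, ← Finset.smul_sum, hB, hab]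

end SliceMatching
end
end

section
/- Let σ be a probability measure on ℝⁿ with finite second moment and let φ : ℝⁿ → ℝ be convex. Assume φ is differentiable at σ-almost every point, φ is differentiable at the mean E(σ), and ∫ ‖∇φ(x)‖² dσ(x) < ∞. Then ∫ ⟨∇φ(x), x⟩ dσ(x) ≥ ⟨ ∫ x dσ(x), ∫ ∇φ(x) dσ(x) ⟩. -/
open MeasureTheory Filter
open scoped ENNReal RealInnerProductSpace BigOperators Topology

noncomputable section

namespace SliceMatching

/-- The gradient of a real-valued function is measurable. -/
lemma measurable_gradient {n : ℕ} (φ : Rn n → ℝ) : Measurable (gradient φ) :=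
  (InnerProductSpace.toDual ℝ (Rn n)).symm.continuous.measurable.comp (measurable_fderiv ℝ φ)

/-- First-order characterization of convexity: the tangent plane lies below the graph. -/
lemma ConvexOn.add_inner_gradient_le {F : Type*} [NormedAddCommGroup F] [InnerProductSpace ℝ F]
    [CompleteSpace F] {φ : F → ℝ} (hφ : ConvexOn ℝ Set.univ φ) {x : F}
    (hx : DifferentiableAt ℝ φ x) (y : F) : φ x + ⟪gradient φ x, y - x⟫ ≤ φ y := by
  have hline : ConvexOn ℝ Set.univ (φ ∘ AffineMap.lineMap (k := ℝ) x y) := by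
    simpa using hφ.comp_affineMap (AffineMap.lineMap (k := ℝ) x y)
  have hderiv : HasDerivAt (φ ∘ AffineMap.lineMap (k := ℝ) x y) ⟪gradient φ x, y - x⟫ 0 := by
    have h0 : AffineMap.lineMap (k := ℝ) x y 0 = x := AffineMap.lineMap_apply_zero x y
    have h := HasFDerivAt.comp_hasDerivAt (0 : ℝ)
      (h0.symm ▸ hx.hasGradientAt.hasFDerivAt) AffineMap.hasDerivAt_lineMap
    simpa using h
  have h := hline.le_slope_of_hasDerivAt (Set.mem_univ 0) (Set.mem_univ 1) one_pos hderiv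
  simp only [slope_def_field, Function.comp_apply, AffineMap.lineMap_apply_zero,
    AffineMap.lineMap_apply_one, sub_zero, div_one] at h
  linarith

/-- The gradient of a convex function is a monotone operator. -/
lemma ConvexOn.inner_gradient_sub_nonneg {F : Type*} [NormedAddCommGroup F]
    [InnerProductSpace ℝ F] [CompleteSpace F] {φ : F → ℝ} (hφ : ConvexOn ℝ Set.univ φ) {x y : F}
    (hx : DifferentiableAt ℝ φ x) (hy : DifferentiableAt ℝ φ y) :
    0 ≤ ⟪gradient φ x - gradient φ y, x - y⟫ := by
  have hxy := ConvexOn.add_inner_gradient_le hφ hx y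
  have hyx := ConvexOn.add_inner_gradient_le hφ hy x
  rw [← neg_sub x y, inner_neg_right] at hxy
  rw [inner_sub_left]
  linarith

/-- Monotonicity inequality for gradients of convex functions:
`∫ ⟪∇φ(x), x⟫ dσ ≥ ⟪∫ x dσ, ∫ ∇φ(x) dσ⟫`. -/
theorem stmt14 {n : ℕ}
    (σ : Measure (Rn n)) [IsProbabilityMeasure σ]
    (hσ2 : Integrable (fun x => ‖x‖ ^ 2) σ)
    (φ : Rn n → ℝ) (hconv : ConvexOn ℝ Set.univ φ)
    (hdiff : ∀ᵐ x ∂σ, DifferentiableAt ℝ φ x)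
    (hdiffE : DifferentiableAt ℝ φ (∫ x, x ∂σ))
    (hgrad2 : Integrable (fun x => ‖gradient φ x‖ ^ 2) σ) :
    ⟪∫ x, x ∂σ, ∫ x, gradient φ x ∂σ⟫ ≤ ∫ x, ⟪gradient φ x, x⟫ ∂σ := by
  set m : Rn n := ∫ x, x ∂σ with hm
  have hX : MemLp (fun x : Rn n => x) 2 σ :=
    (memLp_two_iff_integrable_sq_norm aestronglyMeasurable_id).2 hσ2
  have hG : MemLp (gradient φ) 2 σ :=
    (memLp_two_iff_integrable_sq_norm (measurable_gradient φ).aestronglyMeasurable).2 hgrad2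
  have hXi : Integrable (fun x : Rn n => x) σ := hX.integrable one_le_two
  have hGi : Integrable (gradient φ) σ := hG.integrable one_le_two
  have hGX : Integrable (fun x => ⟪gradient φ x, x⟫) σ := by
    refine (hgrad2.add hσ2).mono' (hG.1.inner hX.1) (ae_of_all _ fun x => ?_)
    calc ‖⟪gradient φ x, x⟫‖ ≤ ‖gradient φ x‖ * ‖x‖ := norm_inner_le_norm _ _
      _ ≤ ‖gradient φ x‖ ^ 2 + ‖x‖ ^ 2 := by
        nlinarith [sq_nonneg (‖gradient φ x‖ - ‖x‖), norm_nonneg x, norm_nonneg (gradient φ x)]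
  have hGm : Integrable (fun x => ⟪m, gradient φ x⟫) σ := hGi.const_inner m
  have hXm : Integrable (fun x => x - m) σ := hXi.sub (integrable_const m)
  have hcX : Integrable (fun x => ⟪gradient φ m, x - m⟫) σ := hXm.const_inner _
  have hGXm : Integrable (fun x => ⟪gradient φ x, x⟫ - ⟪m, gradient φ x⟫) σ := hGX.sub hGm
  have hnonneg : 0 ≤ ∫ x, ⟪gradient φ x, x⟫ - ⟪m, gradient φ x⟫ - ⟪gradient φ m, x - m⟫ ∂σ := by
    refine integral_nonneg_of_ae ?_
    filter_upwards [hdiff] with x hx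
    have h := ConvexOn.inner_gradient_sub_nonneg hconv hx hdiffE
    rwa [inner_sub_left, inner_sub_right (gradient φ x), real_inner_comm m (gradient φ x)] at h
  have hzero : ∫ x, ⟪gradient φ m, x - m⟫ ∂σ = 0 := by
    rw [integral_inner hXm, integral_sub hXi (integrable_const m)]
    simp [← hm]
  rw [integral_sub hGXm hcX, integral_sub hGX hGm, hzero, integral_inner hGi] at hnonneg
  linarith

end SliceMatching
end
end

section
/- Let σ be an absolutely continuous probability measure on ℝⁿ with finite second moment, μ a probability measure on ℝⁿ with finite second moment, and P = [θ₁, …, θₙ] ∈ O(n). Let T : ℝⁿ → ℝⁿ be measurable with T_♯σ = μ, ∫ ‖T(x)‖² dσ(x) < ∞, and W₂²(σ, μ) = ∫ ‖T(x) − x‖² dσ(x) (i.e., T is an optimal transport map from σ to μ). Let (a, b) ∈ ℝ × ℝⁿ be the unique minimizer of (α, β) ↦ ∫ ‖T(x) − αx − β‖² dσ(x) and let (ã, b̃) be the unique minimizer of (α, β) ↦ ∫ ‖T_{σ,μ;P}(x) − αx − β‖² dσ(x); set S(x) = ax + b and S̃(x) = ãx + b̃. Then (∫ ‖S(x) − S̃(x)‖²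 dσ(x))^{1/2} = ( W₂²(σ, μ) − Σᵢ₌₁ⁿ W₂²(σ^{θᵢ}, μ^{θᵢ}) ) / ( 2 √(M₂(σ) − ‖E(σ)‖²) ), and this quantity is nonnegative; in particular S = S̃ if and only if W₂²(σ, μ) = Σᵢ₌₁ⁿ W₂²(σ^{θᵢ}, μ^{θᵢ}). -/
open MeasureTheory Filter
open scoped ENNReal RealInnerProductSpace BigOperators Topology

noncomputable section

namespace SliceMatching

/-! ### The cumulative distribution function and the quantile function -/

lemma cdf_eq_probabilityTheory_cdf (ν : Measure ℝ) [IsProbabilityMeasure ν] (t : ℝ) :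
    cdf ν t = ProbabilityTheory.cdf ν t :=
  (ProbabilityTheory.cdf_eq_real ν t).symm

lemma monotone_cdf (ν : Measure ℝ) [IsProbabilityMeasure ν] : Monotone (cdf ν) := by
  intro s t hst
  simpa only [cdf_eq_probabilityTheory_cdf] using ProbabilityTheory.monotone_cdf ν hst

lemma continuous_cdf (ν : Measure ℝ) [IsProbabilityMeasure ν] [NullSingletonClass ν] :
    Continuous (cdf ν) := by
  rw [show cdf ν = ProbabilityTheory.cdf ν from funext (cdf_eq_probabilityTheory_cdf ν)]
  refine continuous_iff_continuousAt.2 fun x => ?_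
  rw [(ProbabilityTheory.monotone_cdf ν).continuousAt_iff_leftLim_eq_rightLim,
    StieltjesFunction.rightLim_eq]
  have h : (ProbabilityTheory.cdf ν).measure {x} = 0 := by
    rw [ProbabilityTheory.measure_cdf]
    exact measure_singleton x
  rw [StieltjesFunction.measure_singleton, ENNReal.ofReal_eq_zero] at h
  exact le_antisymm ((ProbabilityTheory.monotone_cdf ν).leftLim_le le_rfl) (by linarith)

lemma exists_cdf_lt (ν : Measure ℝ) [IsProbabilityMeasure ν] {p : ℝ} (hp : 0 < p) :
    ∃ t, cdf ν t < p := by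
  obtain ⟨t, ht⟩ := ((ProbabilityTheory.tendsto_cdf_atBot ν).eventually_lt_const hp).exists
  exact ⟨t, by rwa [cdf_eq_probabilityTheory_cdf]⟩

lemma exists_lt_cdf (ν : Measure ℝ) [IsProbabilityMeasure ν] {p : ℝ} (hp : p < 1) :
    ∃ t, p < cdf ν t := by
  obtain ⟨t, ht⟩ := ((ProbabilityTheory.tendsto_cdf_atTop ν).eventually_const_lt hp).exists
  exact ⟨t, by rwa [cdf_eq_probabilityTheory_cdf]⟩

/-- Galois connection between the quantile function and the CDF. -/
lemma quantile_le_iff (ρ : Measure ℝ) [IsProbabilityMeasure ρ] {p : ℝ} (hp0 : 0 < p)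
    (hp1 : p < 1) (t : ℝ) : quantile ρ p ≤ t ↔ p ≤ cdf ρ t := by
  obtain ⟨s, hs⟩ := exists_cdf_lt ρ hp0
  obtain ⟨u, hu⟩ := exists_lt_cdf ρ hp1
  have hbdd : BddBelow {t : ℝ | p ≤ cdf ρ t} :=
    ⟨s, fun v hv => le_of_lt ((monotone_cdf ρ).reflect_lt (hs.trans_le hv))⟩
  refine ⟨fun h => ?_, fun h => csInf_le hbdd h⟩
  have hright : Tendsto (cdf ρ) (𝓝[>] t) (𝓝 (cdf ρ t)) := by
    rw [show cdf ρ = ProbabilityTheory.cdf ρ from funext (cdf_eq_probabilityTheory_cdf ρ)]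
    exact ((ProbabilityTheory.cdf ρ).right_continuous t).mono_left
      (nhdsWithin_mono _ Set.Ioi_subset_Ici_self)
  refine ge_of_tendsto hright (eventually_nhdsWithin_of_forall fun v hv => ?_)
  obtain ⟨w, hw, hwv⟩ := (csInf_lt_iff hbdd ⟨u, hu.le⟩).1 (h.trans_lt hv)
  exact le_trans hw (monotone_cdf ρ hwv.le)

lemma quantile_mono (ρ : Measure ℝ) [IsProbabilityMeasure ρ] :
    MonotoneOn (quantile ρ) (Set.Ioo 0 1) := fun _ hp _ hq hpq =>
  (quantile_le_iff ρ hp.1 hp.2 _).2 (hpq.trans ((quantile_le_iff ρ hq.1 hq.2 _).1 le_rfl))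

/-- The CDF of an atomless measure transports it to the uniform distribution. -/
lemma measureReal_cdf_le (ν : Measure ℝ) [IsProbabilityMeasure ν] [NullSingletonClass ν] {p : ℝ}
    (hp0 : 0 ≤ p) (hp1 : p ≤ 1) : ν.real {x | cdf ν x ≤ p} = p := by
  have hex : ∀ q, 0 < q → q < 1 → ∃ m, cdf ν m = q := fun q h0 h1 => by
    obtain ⟨s, hs⟩ := exists_cdf_lt ν h0
    obtain ⟨u, hu⟩ := exists_lt_cdf ν h1
    exact mem_range_of_exists_le_of_exists_ge (continuous_cdf ν) ⟨s, hs.le⟩ ⟨u, hu.le⟩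
  refine le_antisymm (le_of_forall_gt_imp_ge_of_dense fun q hq => ?_)
    (le_of_forall_lt_imp_le_of_dense fun q hq => ?_)
  · rcases le_or_gt 1 q with h1 | h1
    · exact measureReal_le_one.trans h1
    · obtain ⟨m, rfl⟩ := hex q (hp0.trans_lt hq) h1
      exact measureReal_mono fun x hx => ((monotone_cdf ν).reflect_lt (lt_of_le_of_lt hx hq)).le
  · rcases le_or_gt q 0 with h0 | h0
    · exact h0.trans measureReal_nonneg
    · obtain ⟨m, rfl⟩ := hex q h0 (hq.trans_le hp1)
      exact measureReal_mono fun x hx => (monotone_cdf ν hx).trans hq.le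

lemma ae_cdf_mem_Ioo (ν : Measure ℝ) [IsProbabilityMeasure ν] [NullSingletonClass ν] :
    ∀ᵐ x ∂ν, cdf ν x ∈ Set.Ioo (0 : ℝ) 1 := by
  have h0 : ∀ᵐ x ∂ν, ¬ cdf ν x ≤ 0 := by
    have := measureReal_cdf_le ν le_rfl zero_le_one
    rw [measureReal_eq_zero_iff] at this
    simpa [ae_iff] using this
  have h1 : ∀ᵐ x ∂ν, cdf ν x < 1 := by
    have hle : ∀ p : ℝ, 0 ≤ p → p < 1 → ν.real {x | 1 ≤ cdf ν x} ≤ 1 - p := fun p hp0 hp1 => by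
      have hm : MeasurableSet {x | cdf ν x ≤ p} :=
        measurableSet_le (continuous_cdf ν).measurable measurable_const
      have hc := probReal_compl_eq_one_sub (μ := ν) hm
      rw [measureReal_cdf_le ν hp0 hp1.le] at hc
      rw [← hc]
      exact measureReal_mono fun x (hx : 1 ≤ cdf ν x) =>
        show ¬ cdf ν x ≤ p from not_le.2 (hp1.trans_le hx)
    have hz : ν.real {x | 1 ≤ cdf ν x} = 0 := by
      refine le_antisymm (le_of_not_gt fun hpos => ?_) measureReal_nonneg
      have hone : ν.real {x | 1 ≤ cdf ν x} ≤ 1 := measureReal_le_one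
      have := hle (1 - ν.real {x | 1 ≤ cdf ν x} / 2) (by linarith) (by linarith)
      linarith
    rw [measureReal_eq_zero_iff] at hz
    simpa [ae_iff] using hz
  filter_upwards [h0, h1] with x hx0 hx1 using ⟨not_le.1 hx0, hx1⟩

/-! ### The one-dimensional transport map -/

lemma otMap1d_monotoneOn (ν ρ : Measure ℝ) [IsProbabilityMeasure ν] [IsProbabilityMeasure ρ] :
    MonotoneOn (otMap1d ν ρ) (cdf ν ⁻¹' Set.Ioo 0 1) := fun _ hx _ hy hxy =>
  quantile_mono ρ hx hy (monotone_cdf ν hxy)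

lemma aemeasurable_otMap1d (ν ρ : Measure ℝ) [IsProbabilityMeasure ν] [NullSingletonClass ν]
    [IsProbabilityMeasure ρ] : AEMeasurable (otMap1d ν ρ) ν := by
  have h := aemeasurable_restrict_of_monotoneOn (μ := ν)
    ((continuous_cdf ν).measurable measurableSet_Ioo) (otMap1d_monotoneOn ν ρ)
  rwa [Measure.restrict_eq_self_of_ae_mem
    (show ∀ᵐ x ∂ν, x ∈ cdf ν ⁻¹' Set.Ioo 0 1 from ae_cdf_mem_Ioo ν)] at h

lemma map_otMap1d (ν ρ : Measure ℝ) [IsProbabilityMeasure ν] [NullSingletonClass ν]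
    [IsProbabilityMeasure ρ] : ν.map (otMap1d ν ρ) = ρ := by
  have hT := aemeasurable_otMap1d ν ρ
  have := Measure.isProbabilityMeasure_map hT
  refine Measure.ext_of_Iic _ _ fun t => ?_
  rw [Measure.map_apply_of_aemeasurable hT measurableSet_Iic]
  have hset : (otMap1d ν ρ ⁻¹' Set.Iic t : Set ℝ) =ᵐ[ν] {x | cdf ν x ≤ cdf ρ t} := by
    filter_upwards [ae_cdf_mem_Ioo ν] with x hx
    exact propext (quantile_le_iff ρ hx.1 hx.2 t)
  rw [measure_congr hset, ← measureReal_eq_measureReal_iff,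
    measureReal_cdf_le ν (p := cdf ρ t) ENNReal.toReal_nonneg measureReal_le_one]
  rfl

/-! ### Optimality of monotone transport on the line -/

/-- The region `{(s, t) | x ≤ s < t < y}` has area `((y - x)⁺)² / 2`. -/
lemma volume_triangle (x y : ℝ) :
    volume {q : ℝ × ℝ | q.1 < q.2 ∧ x ≤ q.1 ∧ q.2 < y} =
      ENNReal.ofReal (max (y - x) 0 ^ 2 / 2) := by
  have hset : {q : ℝ × ℝ | q.1 < q.2 ∧ x ≤ q.1 ∧ q.2 < y} =
      regionBetween id (fun _ => y) (Set.Ico x y) := by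
    ext q
    simp only [regionBetween, Set.mem_ofPred_eq, Set.mem_Ico, Set.mem_Ioo, id]
    exact ⟨fun h => ⟨⟨h.2.1, h.1.trans h.2.2⟩, h.1, h.2.2⟩, fun h => ⟨h.2.1, h.1.1, h.2.2⟩⟩
  have hfgInt : ∀ g : ℝ → ℝ, Continuous g → IntegrableOn g (Set.Ico x y) := fun g hg =>
    (hg.integrableOn_Icc).mono_set Set.Ico_subset_Icc_self
  rw [hset, Measure.volume_eq_prod, volume_regionBetween_eq_integral (hfgInt _ continuous_id)
    (hfgInt _ continuous_const) measurableSet_Ico fun s hs => hs.2.le]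
  congr 1
  rcases le_total x y with h | h
  · rw [integral_Ico_eq_integral_Ioc, ← intervalIntegral.integral_of_le h,
      max_eq_left (sub_nonneg.2 h)]
    simp only [Pi.sub_apply, id]
    rw [intervalIntegral.integral_sub (by simp) (by simp)]
    simp
    ring
  · rw [Set.Ico_eq_empty (not_lt.2 h), max_eq_right (sub_nonpos.2 h)]
    simp

lemma ofReal_norm_sub_sq_eq (x y : ℝ) :
    ENNReal.ofReal (‖x - y‖ ^ 2) =
      2 * (volume {q : ℝ × ℝ | q.1 < q.2 ∧ x ≤ q.1 ∧ q.2 < y} +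
        volume {q : ℝ × ℝ | q.1 < q.2 ∧ y ≤ q.1 ∧ q.2 < x}) := by
  rw [volume_triangle, volume_triangle, ← ENNReal.ofReal_add (by positivity) (by positivity),
    ← ENNReal.ofReal_ofNat 2, ← ENNReal.ofReal_mul (by positivity), Real.norm_eq_abs, sq_abs]
  congr 1
  rcases le_total x y with h | h
  · rw [max_eq_left (sub_nonneg.2 h), max_eq_right (sub_nonpos.2 h)]
    ring
  · rw [max_eq_right (sub_nonpos.2 h), max_eq_left (sub_nonneg.2 h)]
    ring

lemma lintegral_volume_triangle (π : Measure (ℝ × ℝ)) [SFinite π] {u v : ℝ × ℝ → ℝ}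
    (hu : Measurable u) (hv : Measurable v) :
    ∫⁻ p, volume {q : ℝ × ℝ | q.1 < q.2 ∧ u p ≤ q.1 ∧ q.2 < v p} ∂π =
      ∫⁻ q in {q : ℝ × ℝ | q.1 < q.2}, π ({p | u p ≤ q.1} \ {p | v p ≤ q.2}) := by
  have hlt : MeasurableSet {q : ℝ × ℝ | q.1 < q.2} :=
    measurableSet_lt measurable_fst measurable_snd
  have hE : MeasurableSet {z : (ℝ × ℝ) × (ℝ × ℝ) |
      z.2.1 < z.2.2 ∧ u z.1 ≤ z.2.1 ∧ z.2.2 < v z.1} := by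
    measurability
  have h1 := Measure.prod_apply (μ := π) (ν := (volume : Measure (ℝ × ℝ))) hE
  have h2 := Measure.prod_apply_symm (μ := π) (ν := (volume : Measure (ℝ × ℝ))) hE
  refine (h1.symm.trans h2).trans ?_
  rw [← lintegral_indicator hlt]
  refine lintegral_congr fun q => ?_
  by_cases hq : q.1 < q.2
  · rw [Set.indicator_of_mem (show q ∈ {q : ℝ × ℝ | q.1 < q.2} from hq)]
    congr 1
    ext p
    simp [hq]
  · rw [Set.indicator_of_notMem (show q ∉ {q : ℝ × ℝ | q.1 < q.2} from hq)]
    simp [hq]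

/-- The quadratic cost of a coupling is governed by the mass it gives to quadrants. -/
lemma lintegral_cost_eq (π : Measure (ℝ × ℝ)) [SFinite π] :
    ∫⁻ p, ENNReal.ofReal (‖p.1 - p.2‖ ^ 2) ∂π =
      2 * ((∫⁻ q in {q : ℝ × ℝ | q.1 < q.2}, π ({p | p.1 ≤ q.1} \ {p | p.2 ≤ q.2})) +
        ∫⁻ q in {q : ℝ × ℝ | q.1 < q.2}, π ({p | p.2 ≤ q.1} \ {p | p.1 ≤ q.2})) := by
  have hmeas : Measurable fun p : ℝ × ℝ =>
      volume {q : ℝ × ℝ | q.1 < q.2 ∧ p.1 ≤ q.1 ∧ q.2 < p.2} := by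
    simp only [volume_triangle]
    fun_prop
  simp only [ofReal_norm_sub_sq_eq]
  rw [lintegral_const_mul' _ _ (by simp), lintegral_add_left hmeas,
    lintegral_volume_triangle π measurable_fst measurable_snd,
    lintegral_volume_triangle π measurable_snd measurable_fst]

/-- If two sets are nested up to null sets, then the mass of their difference is minimal among
all measures giving them the same masses. -/
lemma measure_sdiff_le_of_nested {α : Type*} [MeasurableSpace α] {π₀ π : Measure α}
    [IsFiniteMeasure π₀] [IsFiniteMeasure π] {A B : Set α}
    (hB : MeasurableSet B) (h : π₀ (A \ B) = 0 ∨ π₀ (B \ A) = 0)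
    (hA' : π₀ A = π A) (hB' : π₀ B = π B) (hA : MeasurableSet A) :
    π₀ (A \ B) ≤ π (A \ B) := by
  rcases h with h | h
  · simp [h]
  · have h1 : π₀ A = π₀ (A ∩ B) + π₀ (A \ B) := (measure_inter_add_sdiff A hB).symm
    have h2 : π₀ B = π₀ (A ∩ B) := by
      rw [← measure_inter_add_sdiff B hA, h, add_zero, Set.inter_comm]
    have h3 : π₀ (A \ B) = π₀ A - π₀ B := by
      rw [h1, h2, ENNReal.add_sub_cancel_left (measure_ne_top _ _)]
    rw [h3, hA', hB']
    exact le_measure_sdiff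

/-- A map which is monotone on a set of full measure is optimal for the quadratic cost. -/
lemma lintegral_monotone_le {ν ρ : Measure ℝ} [IsProbabilityMeasure ν] {f : ℝ → ℝ}
    {S : Set ℝ} (hf : AEMeasurable f ν) (hS : ∀ᵐ x ∂ν, x ∈ S) (hmono : MonotoneOn f S)
    (hpush : ν.map f = ρ) (π : Measure (ℝ × ℝ)) (h1 : π.map Prod.fst = ν)
    (h2 : π.map Prod.snd = ρ) :
    ∫⁻ p, ENNReal.ofReal (‖p.1 - p.2‖ ^ 2) ∂(ν.map fun x => (x, f x)) ≤
      ∫⁻ p, ENNReal.ofReal (‖p.1 - p.2‖ ^ 2) ∂π := by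
  have hg : AEMeasurable (fun x => (x, f x)) ν := aemeasurable_id.prodMk hf
  have : IsProbabilityMeasure π := by
    constructor
    rw [← Set.preimage_univ (f := (Prod.fst : ℝ × ℝ → ℝ)),
      ← Measure.map_apply measurable_fst MeasurableSet.univ, h1, measure_univ]
  have := Measure.isProbabilityMeasure_map hg
  set π₀ := ν.map fun x => (x, f x) with hπ₀
  have hm1 : ∀ s, MeasurableSet {p : ℝ × ℝ | p.1 ≤ s} := fun s =>
    measurableSet_le measurable_fst measurable_const
  have hm2 : ∀ s, MeasurableSet {p : ℝ × ℝ | p.2 ≤ s} := fun s =>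
    measurableSet_le measurable_snd measurable_const
  have e1 : ∀ s, π₀ {p : ℝ × ℝ | p.1 ≤ s} = π {p : ℝ × ℝ | p.1 ≤ s} := fun s => by
    rw [hπ₀, Measure.map_apply_of_aemeasurable hg (hm1 s)]
    have := Measure.map_apply (μ := π) measurable_fst (measurableSet_Iic (a := s))
    rw [h1] at this
    exact this
  have e2 : ∀ s, π₀ {p : ℝ × ℝ | p.2 ≤ s} = π {p : ℝ × ℝ | p.2 ≤ s} := fun s => by
    rw [hπ₀, Measure.map_apply_of_aemeasurable hg (hm2 s)]
    have := Measure.map_apply (μ := π) measurable_snd (measurableSet_Iic (a := s))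
    rw [h2, ← hpush, Measure.map_apply_of_aemeasurable hf measurableSet_Iic] at this
    exact this
  have hnest : ∀ s t, π₀ ({p : ℝ × ℝ | p.1 ≤ s} \ {p | p.2 ≤ t}) = 0 ∨
      π₀ ({p : ℝ × ℝ | p.2 ≤ t} \ {p | p.1 ≤ s}) = 0 := fun s t => by
    rw [hπ₀, Measure.map_apply_of_aemeasurable hg ((hm1 s).diff (hm2 t)),
      Measure.map_apply_of_aemeasurable hg ((hm2 t).diff (hm1 s))]
    by_cases hx : ∃ x ∈ S, x ≤ s ∧ t < f x
    · obtain ⟨x, hxS, hxs, hxt⟩ := hx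
      refine Or.inr (measure_eq_zero_iff_ae_notMem.2 ?_)
      filter_upwards [hS] with y hyS hy
      exact absurd (hxt.trans_le (hmono hxS hyS (hxs.trans (not_le.1 hy.2).le))) (not_lt.2 hy.1)
    · refine Or.inl (measure_eq_zero_iff_ae_notMem.2 ?_)
      filter_upwards [hS] with y hyS hy
      exact hx ⟨y, hyS, hy.1, not_le.1 hy.2⟩
  rw [lintegral_cost_eq, lintegral_cost_eq]
  refine mul_le_mul_right (add_le_add (lintegral_mono fun q => ?_) (lintegral_mono fun q => ?_)) 2
  · exact measure_sdiff_le_of_nested (hm2 _) (hnest _ _) (e1 _) (e2 _) (hm1 _)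
  · exact measure_sdiff_le_of_nested (hm1 _) (hnest _ _).symm (e2 _) (e1 _) (hm2 _)

lemma W2sq_eq_integral_otMap1d (ν ρ : Measure ℝ) [IsProbabilityMeasure ν] [NullSingletonClass ν]
    [IsProbabilityMeasure ρ] :
    W2sq ν ρ = ∫ x, ‖x - otMap1d ν ρ x‖ ^ 2 ∂ν := by
  have hT := aemeasurable_otMap1d ν ρ
  have hg : AEMeasurable (fun x => (x, otMap1d ν ρ x)) ν := aemeasurable_id.prodMk hT
  have hcost : Measurable fun p : ℝ × ℝ => ENNReal.ofReal (‖p.1 - p.2‖ ^ 2) := by fun_prop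
  have hmap : ∫⁻ p, ENNReal.ofReal (‖p.1 - p.2‖ ^ 2) ∂(ν.map fun x => (x, otMap1d ν ρ x)) =
      ∫⁻ x, ENNReal.ofReal (‖x - otMap1d ν ρ x‖ ^ 2) ∂ν :=
    lintegral_map' hcost.aemeasurable hg
  have hmeas : AEMeasurable (fun x => ‖x - otMap1d ν ρ x‖ ^ 2) ν :=
    (aemeasurable_id'.sub hT).norm.pow_const 2
  rw [integral_eq_lintegral_of_nonneg_ae (ae_of_all _ fun x => by positivity)
    hmeas.aestronglyMeasurable, ← hmap, W2sq]
  congr 1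
  refine le_antisymm (iInf₂_le _ ⟨?_, ?_⟩) (le_iInf₂ fun π hπ =>
    lintegral_monotone_le hT (ae_cdf_mem_Ioo ν) (otMap1d_monotoneOn ν ρ) (map_otMap1d ν ρ) π
      hπ.1 hπ.2)
  · rw [AEMeasurable.map_map_of_aemeasurable measurable_fst.aemeasurable hg]
    exact Measure.map_id
  · rw [AEMeasurable.map_map_of_aemeasurable measurable_snd.aemeasurable hg]
    exact map_otMap1d ν ρ

/-- Any coupling given by a pair of square integrable maps bounds the Wasserstein distance. -/
lemma W2sq_map_le {Ω α : Type*} [MeasurableSpace Ω] {m : Measure Ω}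
    [MeasurableSpace α] [NormedAddCommGroup α] [BorelSpace α] [SecondCountableTopology α]
    {f g : Ω → α} (hf : Measurable f) (hg : Measurable g)
    (hfgInt : Integrable (fun x => ‖f x - g x‖ ^ 2) m) :
    W2sq (m.map f) (m.map g) ≤ ∫ x, ‖f x - g x‖ ^ 2 ∂m := by
  have hcost : Measurable fun p : α × α => ENNReal.ofReal (‖p.1 - p.2‖ ^ 2) := by fun_prop
  have hnn : 0 ≤ᵐ[m] fun x => ‖f x - g x‖ ^ 2 := ae_of_all _ fun x => by positivity
  rw [integral_eq_lintegral_of_nonneg_ae hnn hfgInt.aestronglyMeasurable, W2sq]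
  have hfin : ∫⁻ x, ENNReal.ofReal (‖f x - g x‖ ^ 2) ∂m ≠ ∞ := by
    rw [← ofReal_integral_eq_lintegral_ofReal hfgInt hnn]
    exact ENNReal.ofReal_ne_top
  refine ENNReal.toReal_mono hfin ?_
  rw [← lintegral_map hcost (hf.prodMk hg)]
  refine iInf₂_le (m.map fun x => (f x, g x)) ⟨?_, ?_⟩
  · rw [Measure.map_map measurable_fst (hf.prodMk hg)]
    rfl
  · rw [Measure.map_map measurable_snd (hf.prodMk hg)]
    rfl

/-! ### Slices and the matrix-slice matching map -/

section Slices

variable {n : ℕ}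

lemma nullSingletonClass_slice {σ : Measure (Rn n)} (hac : σ ≪ volume) {θ : Rn n} (hθ : θ ≠ 0) :
    NullSingletonClass (slice σ θ) := by
  refine ⟨fun t => ?_⟩
  rw [slice, Measure.map_apply (by fun_prop) (measurableSet_singleton t)]
  refine hac ?_
  rcases Set.eq_empty_or_nonempty ((fun x : Rn n => ⟪x, θ⟫) ⁻¹' {t}) with h | ⟨p, hp⟩
  · rw [h, measure_empty]
  · have hp' : ⟪p, θ⟫ = t := hp
    let H : AffineSubspace ℝ (Rn n) := AffineSubspace.mk' p (innerₗ (Rn n) θ).ker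
    have hmem : ∀ x, x ∈ H ↔ ⟪x, θ⟫ = t := fun x => by
      simp [H, AffineSubspace.mem_mk', inner_sub_right, real_inner_comm, sub_eq_zero, ← hp']
    have hH : H ≠ ⊤ := fun h => by
      have : p + θ ∈ H := h ▸ AffineSubspace.mem_top ℝ (Rn n) _
      rw [hmem, inner_add_left, hp'] at this
      exact hθ (inner_self_eq_zero.1 (add_eq_left.1 this))
    refine measure_mono_null (fun x hx => ?_) (Measure.addHaar_affineSubspace volume H hH)
    exact (hmem x).2 hx

instance isProbabilityMeasure_slice (σ : Measure (Rn n)) [IsProbabilityMeasure σ] (θ : Rn n) :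
    IsProbabilityMeasure (slice σ θ) :=
  Measure.isProbabilityMeasure_map (by fun_prop)

/-- Along each direction, the slice matching map has the law of the projection of the target. -/
lemma identDistrib_otMap1d_slice {σ μ : Measure (Rn n)} [IsProbabilityMeasure σ]
    [IsProbabilityMeasure μ] (hac : σ ≪ volume) {T : Rn n → Rn n} (hT : Measurable T)
    (hpush : σ.map T = μ) {θ : Rn n} (hθ : θ ≠ 0) :
    ProbabilityTheory.IdentDistrib (fun x => otMap1d (slice σ θ) (slice μ θ) ⟪x, θ⟫)
      (fun x => ⟪T x, θ⟫) σ σ := by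
  have := nullSingletonClass_slice hac hθ
  have hproj : Measurable fun x : Rn n => ⟪x, θ⟫ := by fun_prop
  have hot := aemeasurable_otMap1d (slice σ θ) (slice μ θ)
  refine ⟨hot.comp_measurable hproj, (hproj.comp hT).aemeasurable, ?_⟩
  have h1 := AEMeasurable.map_map_of_aemeasurable hot hproj.aemeasurable
  have h2 : slice μ θ = σ.map fun x => ⟪T x, θ⟫ := by
    rw [slice, ← hpush, Measure.map_map hproj hT]
    rfl
  rw [← h2]
  exact h1.symm.trans (map_otMap1d (slice σ θ) (slice μ θ))

lemma inner_smMap (σ μ : Measure (Rn n)) (B : OrthonormalBasis (Fin n) ℝ (Rn n)) (x : Rn n)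
    (i : Fin n) :
    ⟪smMap σ μ B x, B i⟫ = otMap1d (slice σ (B i)) (slice μ (B i)) ⟪x, B i⟫ := by
  simp [smMap, sum_inner, inner_smul_left, B.inner_eq_ite]

lemma memLp_smMap {σ μ : Measure (Rn n)} [IsProbabilityMeasure σ] [IsProbabilityMeasure μ]
    (hac : σ ≪ volume) {T : Rn n → Rn n} (hT : Measurable T) (hpush : σ.map T = μ)
    (hT2 : MemLp T 2 σ) (B : OrthonormalBasis (Fin n) ℝ (Rn n)) : MemLp (smMap σ μ B) 2 σ := by
  refine memLp_finsetSum _ fun i _ => ?_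
  have h := ((identDistrib_otMap1d_slice hac hT hpush (B.orthonormal.ne_zero i)).memLp_iff).2
    (hT2.inner_const (B i))
  exact (ContinuousLinearMap.toSpanSingleton ℝ (B i)).comp_memLp' h

lemma integral_smMap {σ μ : Measure (Rn n)} [IsProbabilityMeasure σ] [IsProbabilityMeasure μ]
    (hac : σ ≪ volume) {T : Rn n → Rn n} (hT : Measurable T) (hpush : σ.map T = μ)
    (hT2 : MemLp T 2 σ) (B : OrthonormalBasis (Fin n) ℝ (Rn n)) :
    ∫ x, smMap σ μ B x ∂σ = ∫ x, T x ∂σ := by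
  refine InnerProductSpace.ext_inner_left_basis B.toBasis fun i => ?_
  rw [B.coe_toBasis, ← integral_inner ((memLp_smMap hac hT hpush hT2 B).integrable one_le_two),
    ← integral_inner (hT2.integrable one_le_two)]
  simp only [real_inner_comm _ (B i), inner_smMap]
  exact (identDistrib_otMap1d_slice hac hT hpush (B.orthonormal.ne_zero i)).integral_eq

lemma integral_norm_sq_eq_sum {σ : Measure (Rn n)} {f : Rn n → Rn n} (hf : MemLp f 2 σ)
    (B : OrthonormalBasis (Fin n) ℝ (Rn n)) :
    ∫ x, ‖f x‖ ^ 2 ∂σ = ∑ i, ∫ x, ⟪f x, B i⟫ ^ 2 ∂σ := by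
  rw [← integral_finsetSum _ fun i _ => (hf.inner_const (B i)).integrable_sq]
  refine integral_congr_ae (ae_of_all _ fun x => ?_)
  simpa using (B.sum_sq_norm_inner_left (f x)).symm

lemma integral_norm_smMap_sq {σ μ : Measure (Rn n)} [IsProbabilityMeasure σ]
    [IsProbabilityMeasure μ] (hac : σ ≪ volume) {T : Rn n → Rn n} (hT : Measurable T)
    (hpush : σ.map T = μ) (hT2 : MemLp T 2 σ) (B : OrthonormalBasis (Fin n) ℝ (Rn n)) :
    ∫ x, ‖smMap σ μ B x‖ ^ 2 ∂σ = ∫ x, ‖T x‖ ^ 2 ∂σ := by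
  rw [integral_norm_sq_eq_sum (memLp_smMap hac hT hpush hT2 B) B, integral_norm_sq_eq_sum hT2 B]
  simp only [inner_smMap]
  exact Finset.sum_congr rfl fun i _ =>
    (identDistrib_otMap1d_slice hac hT hpush (B.orthonormal.ne_zero i)).sq.integral_eq

/-- The slice matching map realizes the sum of the slice distances. -/
lemma sum_W2sq_slice {σ μ : Measure (Rn n)} [IsProbabilityMeasure σ] [IsProbabilityMeasure μ]
    (hac : σ ≪ volume) (hσ : MemLp id 2 σ) {T : Rn n → Rn n} (hT : Measurable T)
    (hpush : σ.map T = μ) (hT2 : MemLp T 2 σ) (B : OrthonormalBasis (Fin n) ℝ (Rn n)) :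
    ∑ i, W2sq (slice σ (B i)) (slice μ (B i)) = ∫ x, ‖smMap σ μ B x - x‖ ^ 2 ∂σ := by
  have hdiff : MemLp (fun x => smMap σ μ B x - x) 2 σ := (memLp_smMap hac hT hpush hT2 B).sub hσ
  rw [integral_norm_sq_eq_sum hdiff B]
  refine Finset.sum_congr rfl fun i _ => ?_
  have := nullSingletonClass_slice hac (B.orthonormal.ne_zero i)
  have hproj : AEMeasurable (fun x : Rn n => ⟪x, B i⟫) σ := by fun_prop
  have hmeas : AEMeasurable
      (fun t : ℝ => ‖t - otMap1d (slice σ (B i)) (slice μ (B i)) t‖ ^ 2) (slice σ (B i)) :=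
    (aemeasurable_id'.sub (aemeasurable_otMap1d _ _)).norm.pow_const 2
  rw [W2sq_eq_integral_otMap1d]
  refine (integral_map hproj hmeas.aestronglyMeasurable).trans
    (integral_congr_ae (ae_of_all _ fun x => ?_))
  simp only [inner_sub_left, inner_smMap, Real.norm_eq_abs, sq_abs]
  ring

lemma sum_W2sq_slice_le {σ μ : Measure (Rn n)} (hσ : MemLp id 2 σ) {T : Rn n → Rn n}
    (hT : Measurable T) (hpush : σ.map T = μ) (hT2 : MemLp T 2 σ)
    (B : OrthonormalBasis (Fin n) ℝ (Rn n)) :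
    ∑ i, W2sq (slice σ (B i)) (slice μ (B i)) ≤ ∫ x, ‖T x - x‖ ^ 2 ∂σ := by
  have hdiff : MemLp (fun x => T x - x) 2 σ := hT2.sub hσ
  rw [integral_norm_sq_eq_sum hdiff B]
  refine Finset.sum_le_sum fun i _ => ?_
  have hproj : Measurable fun x : Rn n => ⟪x, B i⟫ := by fun_prop
  have heq : ∀ x, ‖⟪x, B i⟫ - ⟪T x, B i⟫‖ ^ 2 = ⟪T x - x, B i⟫ ^ 2 := fun x => by
    rw [inner_sub_left, Real.norm_eq_abs, sq_abs]
    ring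
  have hle := W2sq_map_le (m := σ) hproj (hproj.comp hT)
    ((hdiff.inner_const (B i)).integrable_sq.congr (ae_of_all _ fun x => (heq x).symm))
  have hslice : slice μ (B i) = σ.map ((fun x => ⟪x, B i⟫) ∘ T) := by
    rw [slice, ← hpush, Measure.map_map hproj hT]
  rw [hslice]
  exact hle.trans_eq (integral_congr_ae (ae_of_all _ heq))

end Slices

/-! ### Registration by translations and scalings -/

section Registration

variable {E : Type*} [NormedAddCommGroup E] [InnerProductSpace ℝ E] [MeasurableSpace E]
  {σ : Measure E} {f g : E → E}

lemma integrable_inner_of_memLp (hf : MemLp f 2 σ) (hg : MemLp g 2 σ) :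
    Integrable (fun x => ⟪f x, g x⟫) σ := by
  refine Integrable.mono' (hf.norm.integrable_mul hg.norm) (hf.1.inner hg.1)
    (ae_of_all _ fun x => norm_inner_le_norm _ _)

lemma integral_norm_sub_sq (hf : MemLp f 2 σ) (hg : MemLp g 2 σ) :
    ∫ x, ‖f x - g x‖ ^ 2 ∂σ =
      ∫ x, ‖f x‖ ^ 2 ∂σ - 2 * ∫ x, ⟪f x, g x⟫ ∂σ + ∫ x, ‖g x‖ ^ 2 ∂σ := by
  have hi := (integrable_inner_of_memLp hf hg).const_mul 2
  have hf2 := hf.integrable_norm_pow two_ne_zero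
  have hg2 := hg.integrable_norm_pow two_ne_zero
  simp only [norm_sub_sq_real]
  have hd : Integrable (fun x => ‖f x‖ ^ 2 - 2 * ⟪f x, g x⟫) σ := hf2.sub hi
  rw [integral_add hd hg2, integral_sub hf2 hi, integral_const_mul]

/-- First order condition at a strict minimizer of a quadratic functional. -/
lemma integral_inner_eq_zero_of_lt (hf : MemLp f 2 σ) (hg : MemLp g 2 σ)
    (hmin : ∀ ε : ℝ, ε ≠ 0 → ∫ x, ‖f x‖ ^ 2 ∂σ < ∫ x, ‖f x - ε • g x‖ ^ 2 ∂σ) :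
    ∫ x, ⟪f x, g x⟫ ∂σ = 0 ∧ 0 < ∫ x, ‖g x‖ ^ 2 ∂σ := by
  have hexp : ∀ ε : ℝ, ε ≠ 0 →
      0 < -2 * ε * (∫ x, ⟪f x, g x⟫ ∂σ) + ε ^ 2 * ∫ x, ‖g x‖ ^ 2 ∂σ := fun ε hε => by
    have h := hmin ε hε
    have h2 := integral_norm_sub_sq hf (hg.const_smul ε)
    simp only [Pi.smul_apply, inner_smul_right, norm_smul, mul_pow, Real.norm_eq_abs, sq_abs,
      integral_const_mul] at h2
    linarith
  have hpos : 0 < ∫ x, ‖g x‖ ^ 2 ∂σ := by linarith [hexp 1 one_ne_zero, hexp (-1) (by norm_num)]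
  refine ⟨?_, hpos⟩
  by_contra hne
  have h := hexp _ (div_ne_zero hne hpos.ne')
  have hsq : 0 < (∫ x, ⟪f x, g x⟫ ∂σ) ^ 2 / ∫ x, ‖g x‖ ^ 2 ∂σ := by positivity
  have heq : -2 * ((∫ x, ⟪f x, g x⟫ ∂σ) / ∫ x, ‖g x‖ ^ 2 ∂σ) * (∫ x, ⟪f x, g x⟫ ∂σ) +
      ((∫ x, ⟪f x, g x⟫ ∂σ) / ∫ x, ‖g x‖ ^ 2 ∂σ) ^ 2 * ∫ x, ‖g x‖ ^ 2 ∂σ =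
      -((∫ x, ⟪f x, g x⟫ ∂σ) ^ 2 / ∫ x, ‖g x‖ ^ 2 ∂σ) := by
    field_simp
    ring
  linarith

variable [IsProbabilityMeasure σ] [CompleteSpace E]

lemma integral_norm_sub_mean_sq (hσ : MemLp id 2 σ) :
    ∫ x, ‖x - ∫ y, y ∂σ‖ ^ 2 ∂σ = (∫ x, ‖x‖ ^ 2 ∂σ) - ‖∫ x, x ∂σ‖ ^ 2 := by
  have h := integral_norm_sub_sq hσ (memLp_const (∫ y, y ∂σ))
  simp only [id, real_inner_comm (∫ y, y ∂σ),
    integral_inner (show Integrable (fun x : E => x) σ from hσ.integrable one_le_two)] at h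
  rw [h]
  simp
  ring

/-- The normal equations of the registration problem. -/
lemma registration_normal_equations (hσ : MemLp id 2 σ) (hf : MemLp f 2 σ) {a : ℝ} {b : E}
    (hab : ∀ α : ℝ, ∀ β : E, (α, β) ≠ (a, b) →
      ∫ x, ‖f x - a • x - b‖ ^ 2 ∂σ < ∫ x, ‖f x - α • x - β‖ ^ 2 ∂σ) :
    ∫ x, f x ∂σ = a • (∫ x, x ∂σ) + b ∧
      ∫ x, ⟪f x, x⟫ ∂σ = a * (∫ x, ‖x‖ ^ 2 ∂σ) + ⟪b, ∫ x, x ∂σ⟫ ∧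
      0 < (∫ x, ‖x‖ ^ 2 ∂σ) - ‖∫ x, x ∂σ‖ ^ 2 := by
  have hid : MemLp (fun x : E => x) 2 σ := hσ
  have hidint : Integrable (fun x : E => x) σ := hid.integrable one_le_two
  have hfint := hf.integrable one_le_two
  have hR : MemLp (fun x => f x - a • x - b) 2 σ :=
    (hf.sub (hid.const_smul a)).sub (memLp_const b)
  have hvar : ∀ (c : ℝ) (v : E), (c, v) ≠ 0 →
      ∫ x, ⟪f x - a • x - b, c • x + v⟫ ∂σ = 0 ∧ 0 < ∫ x, ‖c • x + v‖ ^ 2 ∂σ := by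
    intro c v hcv
    refine integral_inner_eq_zero_of_lt hR ((hid.const_smul c).add (memLp_const v))
      fun ε hε => ?_
    refine (hab (a + ε * c) (b + ε • v) fun h => hcv ?_).trans_eq
      (integral_congr_ae (ae_of_all _ fun x => ?_))
    · simp only [Prod.mk.injEq, add_eq_left, mul_eq_zero, smul_eq_zero, hε, false_or] at h
      simp [h.1, h.2]
    · simp only
      congr 2
      module
  have hmean : ∫ x, f x ∂σ = a • (∫ x, x ∂σ) + b := by
    have h0 : ∫ x, (f x - a • x - b) ∂σ = 0 := by
      refine ext_inner_left ℝ fun v => ?_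
      rw [← integral_inner (hR.integrable one_le_two), inner_zero_right]
      rcases eq_or_ne v 0 with rfl | hv
      · simp
      · have h := (hvar 0 v (by simp [hv])).1
        simpa only [zero_smul, zero_add, real_inner_comm v] using h
    have hs : Integrable (fun x => a • x) σ := hidint.smul a
    have hd : Integrable (fun x => f x - a • x) σ := hfint.sub hs
    rw [integral_sub hd (integrable_const b), integral_sub hfint hs, integral_smul] at h0
    simp only [integral_const, probReal_univ, one_smul] at h0
    rw [← sub_eq_zero, ← h0]
    abel
  refine ⟨hmean, ?_, ?_⟩
  · have h := (hvar 1 0 (by simp)).1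
    simp only [one_smul, add_zero, inner_sub_left, inner_smul_left, real_inner_self_eq_norm_sq]
      at h
    have h1 := integrable_inner_of_memLp hf hid
    have h2 := (hid.integrable_norm_pow two_ne_zero).const_mul a
    have h3 := integrable_inner_of_memLp (memLp_const b) hid
    simp only [conj_trivial] at h
    have hd : Integrable (fun x => ⟪f x, x⟫ - a * ‖x‖ ^ 2) σ := h1.sub h2
    rw [integral_sub hd h3, integral_sub h1 h2, integral_const_mul,
      integral_inner hidint] at h
    linarith
  · have h := (hvar 1 (-∫ x, x ∂σ) (by simp)).2
    simp only [one_smul, ← sub_eq_add_neg] at h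
    rwa [integral_norm_sub_mean_sq hσ] at h

end Registration

/-- Comparison of the translation-and-scaling registrations of `σ` onto
`μ` and onto its slice-matching approximation `(T_{σ,μ;P})_♯σ`. -/
theorem stmt16 {n : ℕ}
    (σ μ : Measure (Rn n)) [IsProbabilityMeasure σ] [IsProbabilityMeasure μ]
    (hac : σ ≪ volume)
    (hσ2 : Integrable (fun x => ‖x‖ ^ 2) σ) (hμ2 : Integrable (fun y => ‖y‖ ^ 2) μ)
    (θ : Fin n → Rn n) (hθ : Orthonormal ℝ θ)
    (T : Rn n → Rn n) (hTmeas : Measurable T) (hTpush : σ.map T = μ)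
    (hT2 : Integrable (fun x => ‖T x‖ ^ 2) σ)
    (hTopt : W2sq σ μ = ∫ x, ‖T x - x‖ ^ 2 ∂σ)
    (a : ℝ) (b : Rn n)
    (hab : ∀ α : ℝ, ∀ β : Rn n, (α, β) ≠ (a, b) →
      ∫ x, ‖T x - a • x - b‖ ^ 2 ∂σ < ∫ x, ‖T x - α • x - β‖ ^ 2 ∂σ)
    (ta : ℝ) (tb : Rn n)
    (htab : ∀ α : ℝ, ∀ β : Rn n, (α, β) ≠ (ta, tb) →
      ∫ x, ‖smMap σ μ θ x - ta • x - tb‖ ^ 2 ∂σ <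
        ∫ x, ‖smMap σ μ θ x - α • x - β‖ ^ 2 ∂σ) :
    Real.sqrt (∫ x, ‖(a • x + b) - (ta • x + tb)‖ ^ 2 ∂σ) =
      (W2sq σ μ - ∑ i, W2sq (slice σ (θ i)) (slice μ (θ i))) /
        (2 * Real.sqrt ((∫ x, ‖x‖ ^ 2 ∂σ) - ‖∫ x, x ∂σ‖ ^ 2)) ∧
    ∑ i, W2sq (slice σ (θ i)) (slice μ (θ i)) ≤ W2sq σ μ ∧
    ((∀ x, a • x + b = ta • x + tb) ↔
      W2sq σ μ = ∑ i, W2sq (slice σ (θ i)) (slice μ (θ i))) := by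
  have hσL : MemLp id 2 σ :=
    (memLp_two_iff_integrable_sq_norm aestronglyMeasurable_id).2 hσ2
  have hTL : MemLp T 2 σ :=
    (memLp_two_iff_integrable_sq_norm hTmeas.aestronglyMeasurable).2 hT2
  obtain ⟨B, rfl⟩ : ∃ B : OrthonormalBasis (Fin n) ℝ (Rn n), ⇑B = θ :=
    ⟨OrthonormalBasis.mk hθ
      (hθ.linearIndependent.span_eq_top_of_card_eq_finrank' (by simp)).ge, by simp⟩
  have hSL := memLp_smMap hac hTmeas hTpush hTL B
  obtain ⟨hm1, hi1, hV⟩ := registration_normal_equations hσL hTL hab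
  obtain ⟨hm2, hi2, -⟩ := registration_normal_equations hσL hSL htab
  have hdiff : tb - b = (a - ta) • ∫ x, x ∂σ := by
    have h := hm1.symm.trans ((integral_smMap hac hTmeas hTpush hTL B).symm.trans hm2)
    rw [← sub_eq_zero] at h ⊢
    rw [← neg_eq_zero, ← h]
    module
  have hle := sum_W2sq_slice_le hσL hTmeas hTpush hTL B
  rw [← hTopt] at hle
  have hgap : W2sq σ μ - ∑ i, W2sq (slice σ (B i)) (slice μ (B i)) =
      2 * (ta - a) * ((∫ x, ‖x‖ ^ 2 ∂σ) - ‖∫ x, x ∂σ‖ ^ 2) := by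
    have e1 := integral_norm_sub_sq hTL hσL
    have e2 := integral_norm_sub_sq hSL hσL
    simp only [id] at e1 e2
    rw [hTopt, sum_W2sq_slice hac hσL hTmeas hTpush hTL B, e1, e2,
      integral_norm_smMap_sq hac hTmeas hTpush hTL B, hi1, hi2]
    have hb : ⟪tb, ∫ x, x ∂σ⟫ - ⟪b, ∫ x, x ∂σ⟫ = (a - ta) * ‖∫ x, x ∂σ‖ ^ 2 := by
      rw [← inner_sub_left, ← real_inner_self_eq_norm_sq, ← real_inner_smul_left]
      rw [hdiff]
    linear_combination 2 * hb
  set V := (∫ x, ‖x‖ ^ 2 ∂σ) - ‖∫ x, x ∂σ‖ ^ 2 with hVdef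
  have hsub : ∀ x, (a • x + b) - (ta • x + tb) = (a - ta) • (x - ∫ y, y ∂σ) := fun x => by
    rw [smul_sub, ← hdiff]
    module
  have hta : 0 ≤ ta - a := by
    by_contra! h
    nlinarith
  refine ⟨?_, hle, fun h => ?_, fun h x => ?_⟩
  · simp only [hsub, norm_smul, mul_pow, integral_const_mul]
    rw [integral_norm_sub_mean_sq hσL, ← hVdef, hgap, Real.sqrt_mul (by positivity),
      Real.sqrt_sq (norm_nonneg _), Real.norm_eq_abs, abs_sub_comm, abs_of_nonneg hta]
    have hs := Real.sqrt_pos.2 hV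
    rw [eq_div_iff (by positivity)]
    linear_combination 2 * (ta - a) * Real.mul_self_sqrt hV.le
  · have hfgInt : ∫ x, ‖(a • x + b) - (ta • x + tb)‖ ^ 2 ∂σ = 0 := by simp [h]
    simp only [hsub, norm_smul, mul_pow, integral_const_mul] at hfgInt
    rw [integral_norm_sub_mean_sq hσL, ← hVdef, mul_eq_zero_iff_right hV.ne'] at hfgInt
    have ha : a - ta = 0 := by simpa using hfgInt
    rw [← sub_eq_zero, hgap]
    linear_combination -2 * V * ha
  · rw [h, sub_self, eq_comm, mul_eq_zero_iff_right hV.ne'] at hgap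
    have ha : a - ta = 0 := by linarith
    rw [← sub_eq_zero, hsub, ha, zero_smul]

end SliceMatching
end
end
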